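/- arXiv:0806.4048 — 4 statements merged into one kernel-verified Lean document; each statement's English description precedes it below -/
import Mathlib

section
/- Let 𝔽 be ℝ or ℂ and let A and B be n×n matrices with entries in 𝔽 (n ≥ 1). Then there exist n×n diagonal matrices X and Y with entries in 𝔽 such that A+X is invertible and the matrix (A+X)⁻¹(B+Y) has n distinct eigenvalues in 𝔽 (i.e., there exist n pairwise distinct elements of 𝔽 each of which is an eigenvalue of (A+X)⁻¹(B+Y)). -/
/-- A square matrix `M` indexed by a finite type `α` (of cardinality `n`) has
`n` distinct eigenvalues in `𝔽` if there is an injective family of elements of `𝔽`,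
indexed by `α`, each of which is an eigenvalue of `M`. -/
def hasDistinctEigenvalues {𝔽 : Type*} [Field 𝔽] {α : Type*} [Fintype α]
    (M : Matrix α α 𝔽) : Prop :=
  ∃ μ : α → 𝔽, Function.Injective μ ∧
    ∀ i, ∃ v : α → 𝔽, v ≠ 0 ∧ M.mulVec v = μ i • v

open Filter Topology Polynomial in
/-- A simple zero `a` of `f (0, ·)` extends to a branch of zeros of `f (s, ·)` for `s` near `0`. -/
theorem exists_tendsto_eventually_eq_zero {𝔽 : Type*} [RCLike 𝔽] {f : 𝔽 × 𝔽 → 𝔽}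
    (hf : ContDiff 𝔽 1 f) {p : 𝔽[X]} (hp : ∀ x, f (0, x) = p.eval x) {a : 𝔽}
    (ha : p.IsRoot a) (ha' : p.derivative.eval a ≠ 0) :
    ∃ ψ : 𝔽 → 𝔽, Tendsto ψ (𝓝 0) (𝓝 a) ∧ ∀ᶠ s in 𝓝 0, f (s, ψ s) = 0 := by
  have hs : HasStrictFDerivAt f (fderiv 𝔽 f (0, a)) (0, a) :=
    hf.contDiffAt.hasStrictFDerivAt one_ne_zero
  have hslice : HasDerivAt (fun x => f (0, x)) (fderiv 𝔽 f (0, a) (0, 1)) a :=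
    hs.hasFDerivAt.comp_hasDerivAt a ((hasDerivAt_const a (0 : 𝔽)).prodMk (hasDerivAt_id a))
  have hderiv : fderiv 𝔽 f (0, a) (0, 1) = p.derivative.eval a := by
    simp only [hp] at hslice
    exact hslice.unique (p.hasDerivAt a)
  have hinv : (fderiv 𝔽 f (0, a) ∘L .inr 𝔽 𝔽 𝔽).IsInvertible := by
    refine ⟨ContinuousLinearEquiv.unitsEquivAut 𝔽 (Units.mk0 _ ha'), ?_⟩
    ext
    simp [hderiv]
  refine ⟨hs.implicitFunctionOfProdDomain hinv, hs.tendsto_implicitFunctionOfProdDomain hinv, ?_⟩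
  filter_upwards [hs.eventually_apply_implicitFunctionOfProdDomain hinv] with s h
  rw [h, hp, ha.eq_zero]

theorem contDiff_det {𝔽 E ι : Type*} [RCLike 𝔽] [NormedAddCommGroup E] [NormedSpace 𝔽 E]
    [Fintype ι] [DecidableEq ι] {M : E → Matrix ι ι 𝔽} (hM : ∀ i j, ContDiff 𝔽 1 fun x => M x i j) :
    ContDiff 𝔽 1 fun x => (M x).det := by
  simp only [Matrix.det_apply']
  fun_prop

/-- Zeros of the generalized characteristic determinant of the pair `(P, Q)` are eigenvalues
of `P⁻¹ * Q`. -/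
theorem exists_mulVec_inv_mul_eq_smul {K ι : Type*} [Field K] [Fintype ι] [DecidableEq ι]
    {P Q : Matrix ι ι K} (hP : IsUnit P.det) {μ : K} (h : (μ • P - Q).det = 0) :
    ∃ v : ι → K, v ≠ 0 ∧ (P⁻¹ * Q).mulVec v = μ • v := by
  obtain ⟨v, hv, hPQ⟩ := Matrix.exists_mulVec_eq_zero_iff.mpr h
  refine ⟨v, hv, ?_⟩
  rw [Matrix.sub_mulVec, Matrix.smul_mulVec, sub_eq_zero] at hPQ
  rw [← Matrix.mulVec_mulVec, ← hPQ, Matrix.mulVec_smul, Matrix.mulVec_mulVec,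
    Matrix.nonsing_inv_mul _ hP, Matrix.one_mulVec]

/-- Let `𝔽` be `ℝ` or `ℂ` and let `A`, `B` be `n × n` matrices over `𝔽` with `n ≥ 1`.
Then there exist diagonal matrices `X`, `Y` over `𝔽` such that `A + X` is invertible
and `(A + X)⁻¹ * (B + Y)` has `n` distinct eigenvalues in `𝔽`. -/
theorem stmt0 {𝔽 : Type*} [RCLike 𝔽] {n : ℕ} (hn : 1 ≤ n)
    (A B : Matrix (Fin n) (Fin n) 𝔽) :
    ∃ X Y : Matrix (Fin n) (Fin n) 𝔽, X.IsDiag ∧ Y.IsDiag ∧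
      IsUnit (A + X).det ∧ hasDistinctEigenvalues ((A + X)⁻¹ * (B + Y)) := by
  open Filter Topology in
  let d : Fin n → 𝔽 := fun i => (i : ℕ)
  have hd : Function.Injective d := Nat.cast_injective.comp Fin.val_injective
  let F : 𝔽 → 𝔽 → Matrix (Fin n) (Fin n) 𝔽 :=
    fun s x => x • (1 + s • A) - (Matrix.diagonal d + s • B)
  let p : Polynomial 𝔽 := ∏ i, (Polynomial.X - Polynomial.C (d i))
  have hsep : p.Separable := Polynomial.separable_prod_X_sub_C_iff.mpr hd
  have hF : ContDiff 𝔽 1 fun z : 𝔽 × 𝔽 => (F z.1 z.2).det := by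
    refine contDiff_det fun i j => ?_
    simp only [F, Matrix.sub_apply, Matrix.add_apply, Matrix.smul_apply, smul_eq_mul]
    fun_prop
  have hFp (x : 𝔽) : (F 0 x).det = p.eval x := by
    simp only [F, zero_smul, add_zero, p, Polynomial.eval_prod, Polynomial.eval_sub,
      Polynomial.eval_X, Polynomial.eval_C]
    rw [Matrix.smul_one_eq_diagonal, Matrix.diagonal_sub, Matrix.det_diagonal]
  have hroot (i : Fin n) : p.IsRoot (d i) := by
    simp only [p, Polynomial.IsRoot.def, Polynomial.eval_prod]
    exact Finset.prod_eq_zero (Finset.mem_univ i) (by simp)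
  have hbranch (i : Fin n) := exists_tendsto_eventually_eq_zero hF hFp (hroot i)
    (by simpa using hsep.aeval_derivative_ne_zero (x := d i) (by simpa using (hroot i).eq_zero))
  choose ψ hψ hψ0 using hbranch
  have hinj : ∀ᶠ s in 𝓝 (0 : 𝔽), ∀ i j, i ≠ j → ψ i s ≠ ψ j s := by
    simp only [eventually_all]
    exact fun i j hij => ((hψ i).prodMk_nhds (hψ j)).eventually
      (isOpen_ne_fun continuous_fst continuous_snd |>.mem_nhds (hd.ne hij))
  have hdet : ∀ᶠ s in 𝓝 (0 : 𝔽), (1 + s • A).det ≠ 0 := by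
    have hcont : Continuous fun s : 𝔽 => (1 + s • A).det := by fun_prop
    exact hcont.continuousAt.eventually_ne (by simp)
  obtain ⟨s, ⟨hs_inj, hs_det, hs_zero⟩, hs⟩ :=
    (((hinj.and (hdet.and (eventually_all.mpr hψ0))).filter_mono
      (nhdsWithin_le_nhds (s := {0}ᶜ))).and self_mem_nhdsWithin).exists
  have hs : s ≠ 0 := hs
  have hA : A + Matrix.diagonal (fun _ => s⁻¹) = s⁻¹ • (1 + s • A) := by
    rw [smul_add, inv_smul_smul₀ hs, Matrix.smul_one_eq_diagonal, add_comm]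
  have hB : B + s⁻¹ • Matrix.diagonal d = s⁻¹ • (Matrix.diagonal d + s • B) := by
    rw [smul_add, inv_smul_smul₀ hs, add_comm]
  have hunit : IsUnit (A + Matrix.diagonal (fun _ => s⁻¹)).det := by
    rw [hA, Matrix.det_smul]
    exact (mul_ne_zero (pow_ne_zero _ (inv_ne_zero hs)) hs_det).isUnit
  refine ⟨Matrix.diagonal fun _ => s⁻¹, s⁻¹ • Matrix.diagonal d, Matrix.isDiag_diagonal _,
    (Matrix.isDiag_diagonal d).smul _, hunit, fun i => ψ i s,
    fun i j hij => not_imp_not.mp (hs_inj i j) hij, fun i =>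
      exists_mulVec_inv_mul_eq_smul hunit ?_⟩
  rw [hA, hB, smul_comm, ← smul_sub, Matrix.det_smul]
  exact mul_eq_zero_of_right _ (hs_zero i)
end

section
/- Let 𝔽 be ℝ or ℂ, let A and B be n×n matrices with entries in 𝔽, and let 1 ≤ i_1 < i_2 < … < i_r ≤ n be indices such that the r×r principal submatrix A' of A on rows and columns i_1,…,i_r is invertible and (A')⁻¹B' has r distinct eigenvalues in 𝔽, where B' is the corresponding r×r principal submatrix of B. Then there exist n×n diagonal matrices X and Y with entries in 𝔽 whose (i_u,i_u) entries are zero for u = 1,…,r, such that A+X is invertible and (A+X)⁻¹(B+Y) has n distinct eigenvalues in 𝔽. -/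
open Filter Topology Polynomial

theorem eventually_exists_zero_of_hasStrictFDerivAt {𝕜 : Type*} [RCLike 𝕜]
    {f : 𝕜 × 𝕜 → 𝕜} {f' : 𝕜 × 𝕜 →L[𝕜] 𝕜} {a b : 𝕜}
    (hf : HasStrictFDerivAt f f' (a, b)) (hf' : f' (0, 1) ≠ 0) (h0 : f (a, b) = 0)
    {U : Set 𝕜} (hU : U ∈ 𝓝 b) : ∀ᶠ s in 𝓝 a, ∃ x ∈ U, f (s, x) = 0 := by
  have hΦ : HasStrictFDerivAt (fun z : 𝕜 × 𝕜 => (z.1, f z))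
      ((ContinuousLinearMap.fst 𝕜 𝕜 𝕜).prod f') (a, b) := hasStrictFDerivAt_fst.prodMk hf
  have hsurj : ((ContinuousLinearMap.fst 𝕜 𝕜 𝕜).prod f').range = ⊤ := by
    refine LinearMap.range_eq_top.2 fun ⟨u, w⟩ => ⟨(u, (w - f' (u, 0)) / f' (0, 1)), ?_⟩
    have hsplit : ∀ t : 𝕜, f' (u, t) = f' (u, 0) + t * f' (0, 1) := fun t => by
      rw [← smul_eq_mul, ← map_smul, ← map_add]
      simp
    refine Prod.ext rfl ?_
    change f' (u, _) = w
    rw [hsplit, div_mul_cancel₀ _ hf']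
    ring
  have hmem : (fun z : 𝕜 × 𝕜 => (z.1, f z)) '' (Set.univ ×ˢ U) ∈ 𝓝 (a, (0 : 𝕜)) := by
    rw [← h0, ← hΦ.map_nhds_eq_of_surj hsurj]
    exact image_mem_map (prod_mem_nhds univ_mem hU)
  have hcont : Tendsto (fun s : 𝕜 => (s, (0 : 𝕜))) (𝓝 a) (𝓝 (a, 0)) :=
    (Continuous.prodMk_left (0 : 𝕜)).tendsto a
  filter_upwards [hcont hmem] with s hs
  obtain ⟨⟨s', x⟩, ⟨-, hx⟩, h⟩ := hs
  obtain ⟨rfl, hx0⟩ : s' = s ∧ f (s', x) = 0 := Prod.mk.inj h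
  exact ⟨x, hx, hx0⟩

theorem eventually_exists_injective_zeros {𝕜 α : Type*} [RCLike 𝕜] [Fintype α]
    {f : 𝕜 × 𝕜 → 𝕜} (hf : ContDiff 𝕜 1 f) {c a : 𝕜} (hc : c ≠ 0) {μ : α → 𝕜}
    (hμ : Function.Injective μ) (hfa : ∀ x, f (a, x) = c * ∏ j, (x - μ j)) :
    ∀ᶠ s in 𝓝 a, ∃ ν : α → 𝕜, Function.Injective ν ∧ ∀ j, f (s, ν j) = 0 := by
  classical
  obtain ⟨U, hU, hdisj⟩ := Pairwise.exists_mem_filter_of_disjoint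
    (l := fun j => 𝓝 (μ j)) fun j k hjk => disjoint_nhds_nhds.2 (hμ.ne hjk)
  have key : ∀ j, ∀ᶠ s in 𝓝 a, ∃ x ∈ U j, f (s, x) = 0 := fun j => by
    have hs := hf.hasStrictFDerivAt (x := (a, μ j)) one_ne_zero
    refine eventually_exists_zero_of_hasStrictFDerivAt hs ?_ ?_ (hU j)
    · have h1 : HasDerivAt (fun x => f (a, x)) (fderiv 𝕜 f (a, μ j) (0, 1)) (μ j) :=
        hs.hasFDerivAt.comp_hasDerivAt (μ j)
          ((hasDerivAt_const (μ j) a).prodMk (hasDerivAt_id (μ j)))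
      have h2 : HasDerivAt (fun x => (x - μ j) * (c * ∏ k ∈ Finset.univ.erase j, (x - μ k)))
          (c * ∏ k ∈ Finset.univ.erase j, (μ j - μ k)) (μ j) := by
        have hg : DifferentiableAt 𝕜
            (fun x => c * ∏ k ∈ Finset.univ.erase j, (x - μ k)) (μ j) := by fun_prop
        simpa using ((hasDerivAt_id' (μ j)).sub_const (μ j)).fun_mul hg.hasDerivAt
      have heq : (fun x => f (a, x)) =
          fun x => (x - μ j) * (c * ∏ k ∈ Finset.univ.erase j, (x - μ k)) := by
        funext x
        rw [hfa, ← Finset.mul_prod_erase _ _ (Finset.mem_univ j)]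
        ring
      rw [heq] at h1
      rw [h1.unique h2]
      refine mul_ne_zero hc (Finset.prod_ne_zero_iff.2 fun k hk => sub_ne_zero.2 ?_)
      exact hμ.ne (Finset.ne_of_mem_erase hk).symm
    · rw [hfa, Finset.prod_eq_zero (Finset.mem_univ j) (sub_self _), mul_zero]
  filter_upwards [eventually_all.2 key] with s hs
  choose ν hνU hν using hs
  refine ⟨ν, fun j k hjk => ?_, hν⟩
  by_contra hne
  exact Set.disjoint_left.1 (hdisj hne) (hνU j) (hjk ▸ hνU k)

theorem Matrix.det_smul_sub_eq_of_eigenvalues {K α : Type*} [Field K] [Fintype α] [DecidableEq α]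
    {A B : Matrix α α K} (hA : IsUnit A.det) {μ : α → K} (hμ : Function.Injective μ)
    (hv : ∀ j, ∃ v : α → K, v ≠ 0 ∧ (A⁻¹ * B).mulVec v = μ j • v) (x : K) :
    (x • A - B).det = A.det * ∏ j, (x - μ j) := by
  have hroot : ∀ j, X - C (μ j) ∣ (A⁻¹ * B).charpoly := fun j => by
    obtain ⟨v, hv0, hv⟩ := hv j
    rw [dvd_iff_isRoot, IsRoot, Matrix.eval_charpoly, ← Matrix.exists_mulVec_eq_zero_iff]
    refine ⟨v, hv0, ?_⟩
    rw [Matrix.sub_mulVec, hv, Matrix.scalar_apply, ← Matrix.smul_one_eq_diagonal,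
      Matrix.smul_mulVec, Matrix.one_mulVec, sub_self]
  have hdvd : ∏ j, (X - C (μ j)) ∣ (A⁻¹ * B).charpoly :=
    Finset.prod_dvd_of_coprime
      (fun j _ k _ hjk => pairwise_coprime_X_sub_C hμ hjk) fun j _ => hroot j
  have hcp := eq_of_monic_of_dvd_of_natDegree_le (monic_prod_X_sub_C μ Finset.univ)
    (Matrix.charpoly_monic (A⁻¹ * B)) hdvd (by simp)
  have hfac : x • A - B = A * (Matrix.scalar α x - A⁻¹ * B) := by
    rw [mul_sub, ← mul_assoc, Matrix.mul_nonsing_inv _ hA, one_mul, Matrix.scalar_apply,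
      ← Matrix.smul_one_eq_diagonal, mul_smul_comm, mul_one]
  rw [hfac, Matrix.det_mul, ← Matrix.eval_charpoly, hcp, eval_prod]
  simp

theorem Matrix.det_eq_det_submatrix_mul_prod_diag {R α β : Type*} [CommRing R] [Fintype α]
    [DecidableEq α] [Fintype β] [DecidableEq β] {i : β → α} (hi : Function.Injective i)
    [DecidablePred (· ∈ Set.range i)] (M : Matrix α α R)
    (hM : ∀ a b, b ∉ Set.range i → a ≠ b → M a b = 0) :
    M.det = (M.submatrix i i).det * ∏ j : {j // j ∉ Set.range i}, M j j := by
  rw [M.twoBlockTriangular_det' (· ∈ Set.range i)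
    fun a ha b hb => hM a b hb fun h => hb (h ▸ ha)]
  congr 1
  · let := Subtype.fintype (· ∈ Set.range i)
    let e : β ≃ {a // a ∈ Set.range i} := Equiv.ofInjective i hi
    exact (Matrix.det_submatrix_equiv_self e (M.toSquareBlockProp (· ∈ Set.range i))).symm
  · rw [← Matrix.det_diagonal]
    congr 1
    ext a b
    by_cases hab : a = b
    · subst hab
      simp [Matrix.toSquareBlockProp_def]
    · rw [Matrix.diagonal_apply_ne _ hab]
      exact hM a b b.2 fun h => hab (Subtype.ext h)

theorem ContDiff.matrix_det {𝕜 E α : Type*} [RCLike 𝕜] [NormedAddCommGroup E] [NormedSpace 𝕜 E]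
    [Fintype α] [DecidableEq α] {m : WithTop ℕ∞} {M : E → Matrix α α 𝕜}
    (hM : ∀ a b, ContDiff 𝕜 m fun z => M z a b) : ContDiff 𝕜 m fun z => (M z).det := by
  simp only [Matrix.det_apply']
  exact ContDiff.sum fun σ _ => contDiff_const.mul (contDiff_prod fun a _ => hM _ _)

theorem Function.Injective.exists_injective_extension {α β γ : Type*} [Countable α] [Finite β]
    [Infinite γ] {i : β → α} (hi : Function.Injective i) {μ : β → γ}
    (hμ : Function.Injective μ) : ∃ ν : α → γ, Function.Injective ν ∧ ∀ u, ν (i u) = μ u := by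
  obtain ⟨g, hg⟩ := exists_injective_nat α
  have := (Set.finite_range μ).infinite_compl.to_subtype
  let e := Infinite.natEmbedding ↥(Set.range μ)ᶜ
  refine ⟨Function.extend i μ fun j => e (g j), fun a b hab => ?_, hi.extend_apply μ _⟩
  by_cases ha : ∃ u, i u = a <;> by_cases hb : ∃ u, i u = b
  · obtain ⟨u, rfl⟩ := ha
    obtain ⟨w, rfl⟩ := hb
    rw [hi.extend_apply, hi.extend_apply] at hab
    rw [hμ hab]
  · obtain ⟨u, rfl⟩ := ha
    rw [hi.extend_apply, Function.extend_apply' _ _ _ hb] at hab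
    exact absurd ⟨u, hab⟩ (e (g b)).2
  · obtain ⟨w, rfl⟩ := hb
    rw [hi.extend_apply, Function.extend_apply' _ _ _ ha] at hab
    exact absurd ⟨w, hab.symm⟩ (e (g a)).2
  · rw [Function.extend_apply' _ _ _ ha, Function.extend_apply' _ _ _ hb] at hab
    exact hg (e.injective (Subtype.ext hab))

theorem Matrix.hasDistinctEigenvalues_inv_mul {K α : Type*} [Field K] [Fintype α] [DecidableEq α]
    {A B : Matrix α α K} (hA : IsUnit A.det) {ν : α → K} (hν : Function.Injective ν)
    (h : ∀ j, (ν j • A - B).det = 0) : hasDistinctEigenvalues (A⁻¹ * B) := by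
  refine ⟨ν, hν, fun j => ?_⟩
  obtain ⟨v, hv0, hv⟩ := Matrix.exists_mulVec_eq_zero_iff.2 (h j)
  refine ⟨v, hv0, ?_⟩
  rw [Matrix.sub_mulVec, sub_eq_zero, Matrix.smul_mulVec] at hv
  rw [← Matrix.mulVec_mulVec, ← hv, Matrix.mulVec_smul, Matrix.mulVec_mulVec,
    Matrix.nonsing_inv_mul _ hA, Matrix.one_mulVec]

/-- Let `𝔽` be `ℝ` or `ℂ`, `A`, `B` be `n × n` matrices over `𝔽`, and
`i : Fin r → Fin n` a strictly increasing family of indices such that the principal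
submatrix `A'` of `A` on rows and columns `i 0, …, i (r-1)` is invertible and
`A'⁻¹ * B'` has `r` distinct eigenvalues in `𝔽` (`B'` the corresponding principal
submatrix of `B`).  Then there are diagonal matrices `X`, `Y` over `𝔽`, vanishing
at the diagonal cells `(i u, i u)`, such that `A + X` is invertible and
`(A + X)⁻¹ * (B + Y)` has `n` distinct eigenvalues in `𝔽`. -/
theorem stmt1 {𝔽 : Type*} [RCLike 𝔽] {n r : ℕ}
    (A B : Matrix (Fin n) (Fin n) 𝔽)
    (i : Fin r → Fin n) (hi : StrictMono i)
    (hA' : IsUnit (A.submatrix i i).det)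
    (hAB' : hasDistinctEigenvalues ((A.submatrix i i)⁻¹ * (B.submatrix i i))) :
    ∃ X Y : Matrix (Fin n) (Fin n) 𝔽, X.IsDiag ∧ Y.IsDiag ∧
      (∀ u : Fin r, X (i u) (i u) = 0 ∧ Y (i u) (i u) = 0) ∧
      IsUnit (A + X).det ∧ hasDistinctEigenvalues ((A + X)⁻¹ * (B + Y)) := by
  classical
  obtain ⟨μ, hμ, hv⟩ := hAB'
  obtain ⟨d, hd, hdμ⟩ := hi.injective.exists_injective_extension hμ
  let ε : Fin n → 𝔽 := fun j => if j ∈ Set.range i then 0 else 1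
  let σ : 𝔽 → Fin n → 𝔽 := fun s j => if j ∈ Set.range i then 1 else s
  let P : 𝔽 → Matrix (Fin n) (Fin n) 𝔽 := fun s =>
    A * Matrix.diagonal (σ s) + Matrix.diagonal ε
  let Q : 𝔽 → Matrix (Fin n) (Fin n) 𝔽 := fun s =>
    B * Matrix.diagonal (σ s) + Matrix.diagonal (ε * d)
  have hε_mem : ∀ u, ε (i u) = 0 := fun u => if_pos ⟨u, rfl⟩
  have hσ_mem : ∀ s u, σ s (i u) = 1 := fun s u => if_pos ⟨u, rfl⟩
  have hε_notMem : ∀ j ∉ Set.range i, ε j = 1 := fun j hj => if_neg hj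
  have hσ_notMem : ∀ s, ∀ j ∉ Set.range i, σ s j = s := fun s j hj => if_neg hj
  have hσ : ∀ b, ContDiff 𝔽 1 fun s => σ s b := fun b => by
    by_cases hb : b ∈ Set.range i
    · simpa only [σ, if_pos hb] using contDiff_const
    · simpa only [σ, if_neg hb] using contDiff_fun_id
  have hP : ∀ a b, ContDiff 𝔽 1 fun s => P s a b := fun a b => by
    simp only [P, Matrix.add_apply, Matrix.mul_diagonal]
    exact (contDiff_const.mul (hσ b)).add contDiff_const
  have hQ : ∀ a b, ContDiff 𝔽 1 fun s => Q s a b := fun a b => by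
    simp only [Q, Matrix.add_apply, Matrix.mul_diagonal]
    exact (contDiff_const.mul (hσ b)).add contDiff_const
  have hPQ : ContDiff 𝔽 1 fun z : 𝔽 × 𝔽 => (z.2 • P z.1 - Q z.1).det := by
    refine ContDiff.matrix_det fun a b => ?_
    simp only [Matrix.sub_apply, Matrix.smul_apply, smul_eq_mul]
    exact (contDiff_snd.mul ((hP a b).comp contDiff_fst)).sub ((hQ a b).comp contDiff_fst)
  have hP0 : ∀ a b, b ∉ Set.range i → P 0 a b = if a = b then 1 else 0 := fun a b hb => by
    by_cases hab : a = b
    · simp [P, hab, hσ_notMem _ b hb, hε_notMem b hb]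
    · simp [P, hab, hσ_notMem _ b hb]
  have hQ0 : ∀ a b, b ∉ Set.range i → Q 0 a b = if a = b then d b else 0 := fun a b hb => by
    by_cases hab : a = b
    · simp [Q, hab, hσ_notMem _ b hb, hε_notMem b hb]
    · simp [Q, hab, hσ_notMem _ b hb]
  have hsubP : (P 0).submatrix i i = A.submatrix i i := by
    ext u w
    simp [P, Matrix.diagonal_apply, hε_mem, hσ_mem]
  have hsubQ : (Q 0).submatrix i i = B.submatrix i i := by
    ext u w
    simp [Q, Matrix.diagonal_apply, hε_mem, hσ_mem]
  have hdetP : (P 0).det = (A.submatrix i i).det := by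
    rw [Matrix.det_eq_det_submatrix_mul_prod_diag hi.injective (P 0)
      fun a b hb hab => by rw [hP0 a b hb, if_neg hab], hsubP,
      Finset.prod_eq_one fun j _ => by rw [hP0 j j j.2, if_pos rfl], mul_one]
  have hdet : ∀ x, (x • P 0 - Q 0).det = (A.submatrix i i).det * ∏ j, (x - d j) := fun x => by
    rw [Matrix.det_eq_det_submatrix_mul_prod_diag hi.injective (x • P 0 - Q 0)
      fun a b hb hab => by simp [hP0 a b hb, hQ0 a b hb, hab]]
    have hsub : (x • P 0 - Q 0).submatrix i i = x • A.submatrix i i - B.submatrix i i := by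
      rw [← hsubP, ← hsubQ]
      rfl
    rw [hsub, Matrix.det_smul_sub_eq_of_eigenvalues hA' hμ hv, mul_assoc,
      ← Fintype.prod_subtype_mul_prod_subtype (· ∈ Set.range i) fun j => x - d j]
    refine congrArg _ (congrArg₂ _ ?_ ?_)
    · let := Subtype.fintype (· ∈ Set.range i)
      exact Fintype.prod_equiv (Equiv.ofInjective i hi.injective) (fun u => x - μ u)
        (fun j => x - d j) fun u => by simp [hdμ]
    · exact Finset.prod_congr rfl fun j _ => by simp [hP0 j j j.2, hQ0 j j j.2]
  have hroots := eventually_exists_injective_zeros hPQ hA'.ne_zero hd hdet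
  have hunit : ∀ᶠ s in 𝓝 (0 : 𝔽), (P s).det ≠ 0 :=
    (ContDiff.matrix_det hP).continuous.continuousAt.eventually_ne
      (by rw [hdetP]; exact hA'.ne_zero)
  obtain ⟨s, ⟨⟨ν, hν, hνs⟩, hPs⟩, hs⟩ :=
    (((hroots.and hunit).filter_mono nhdsWithin_le_nhds).and
      (self_mem_nhdsWithin (s := ({0}ᶜ : Set 𝔽)))).exists
  have hs0 : s ≠ 0 := hs
  have hscale : ∀ (M : Matrix (Fin n) (Fin n) 𝔽) (e : Fin n → 𝔽),
      (M + Matrix.diagonal (s⁻¹ • (ε * e))) * Matrix.diagonal (σ s) =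
        M * Matrix.diagonal (σ s) + Matrix.diagonal (ε * e) := fun M e => by
    rw [add_mul, Matrix.diagonal_mul_diagonal]
    congr 2
    funext j
    by_cases hj : j ∈ Set.range i
    · obtain ⟨u, rfl⟩ := hj
      simp [hε_mem]
    · simp only [Pi.smul_apply, Pi.mul_apply, hε_notMem j hj, hσ_notMem s j hj, smul_eq_mul]
      field_simp
  have hPfac := hscale A 1
  rw [mul_one] at hPfac
  have hQfac := hscale B d
  have hXdet : (A + Matrix.diagonal (s⁻¹ • ε)).det ≠ 0 := fun h =>
    hPs (by simp only [P]; rw [← hPfac, Matrix.det_mul, h, zero_mul])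
  refine ⟨Matrix.diagonal (s⁻¹ • ε), Matrix.diagonal (s⁻¹ • (ε * d)),
    Matrix.isDiag_diagonal _, Matrix.isDiag_diagonal _, fun u => by simp [hε_mem],
    isUnit_iff_ne_zero.2 hXdet,
    Matrix.hasDistinctEigenvalues_inv_mul (isUnit_iff_ne_zero.2 hXdet) hν fun j => ?_⟩
  have hσs : (Matrix.diagonal (σ s)).det ≠ 0 := by
    rw [Matrix.det_diagonal]
    refine Finset.prod_ne_zero_iff.2 fun k _ => ?_
    by_cases hk : k ∈ Set.range i
    · obtain ⟨u, rfl⟩ := hk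
      simp [hσ_mem]
    · rwa [hσ_notMem s k hk]
  refine (mul_eq_zero.1 ?_).resolve_right hσs
  rw [← Matrix.det_mul, sub_mul, Matrix.smul_mul, hPfac, hQfac]
  exact hνs j
end

section
/- Let 𝔽 be ℝ or ℂ and let n, m, p be positive integers with n ≤ m and p odd. Then max.rank_𝔽(n,m,p) ≤ n + m(p−1)/2. -/
/-- The rank of a 3-tensor, presented as a family of matrices (its slices):
the least `r` such that each slice `A k` is `∑ i, (c i k) • (a i) (b i)ᵀ`
for some vectors `a i`, `b i`, `c i`. -/
noncomputable def tensorRank (𝔽 : Type*) [Field 𝔽] {α β γ : Type*}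
    [Fintype α] [Fintype β] [Fintype γ] (A : γ → Matrix α β 𝔽) : ℕ :=
  sInf {r : ℕ | ∃ (a : Fin r → α → 𝔽) (b : Fin r → β → 𝔽) (c : Fin r → γ → 𝔽),
    ∀ k, A k = ∑ i, c i k • Matrix.vecMulVec (a i) (b i)}

/-- `maxRank 𝔽 m n p` is the maximal rank of an `m × n × p` tensor over `𝔽`. -/
noncomputable def maxRank (𝔽 : Type*) [Field 𝔽] (m n p : ℕ) : ℕ :=
  sSup {r : ℕ | ∃ A : Fin p → Matrix (Fin m) (Fin n) 𝔽, tensorRank 𝔽 A = r}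

open Topology in
/-- A perturbation of the identity of `E` with vanishing linear part hits a nonzero multiple of
every vector. -/
theorem exists_smul_eq_add_of_hasStrictFDerivAt_zero {𝕜 E : Type*} [RCLike 𝕜]
    [NormedAddCommGroup E] [NormedSpace 𝕜 E] [FiniteDimensional 𝕜 E] {Q : E → E} (hQ0 : Q 0 = 0)
    (hQ : HasStrictFDerivAt Q (0 : E →L[𝕜] E) 0) (w : E) :
    ∃ (ε : 𝕜) (z : E), ε ≠ 0 ∧ z + Q z = ε • w := by
  have : CompleteSpace E := FiniteDimensional.complete 𝕜 E
  have hF : HasStrictFDerivAt (fun z ↦ z + Q z) (ContinuousLinearMap.id 𝕜 E) 0 := by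
    have h := (hasStrictFDerivAt_id (𝕜 := 𝕜) (0 : E)).add hQ
    rwa [add_zero] at h
  have hmap := hF.map_nhds_eq_of_surj (LinearMap.range_eq_top.2 Function.surjective_id)
  have hrange : Set.range (fun z ↦ z + Q z) ∈ 𝓝 (0 : E) := by
    have h := Filter.range_mem_map (f := 𝓝 (0 : E)) (m := fun z ↦ z + Q z)
    rwa [hmap, hQ0, add_zero] at h
  have hlim : Filter.Tendsto (fun ε : 𝕜 ↦ ε • w) (𝓝[≠] 0) (𝓝 0) := by
    have h : Filter.Tendsto (fun ε : 𝕜 ↦ ε • w) (𝓝 0) (𝓝 ((0 : 𝕜) • w)) :=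
      (continuous_id.smul continuous_const).tendsto 0
    rw [zero_smul] at h
    exact h.mono_left nhdsWithin_le_nhds
  obtain ⟨ε, ⟨z, hz⟩, hε⟩ := ((hlim.eventually_mem hrange).and self_mem_nhdsWithin).exists
  exact ⟨ε, z, hε, hz⟩

/-- The product of two continuous linear maps has vanishing derivative at the origin. -/
theorem hasStrictFDerivAt_zero_mul {𝕜 E 𝔸 : Type*} [NontriviallyNormedField 𝕜]
    [NormedAddCommGroup E] [NormedSpace 𝕜 E] [NormedRing 𝔸] [NormedAlgebra 𝕜 𝔸]
    (f g : E →L[𝕜] 𝔸) : HasStrictFDerivAt (fun z ↦ f z * g z) (0 : E →L[𝕜] 𝔸) 0 := by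
  refine (f.hasStrictFDerivAt.mul' g.hasStrictFDerivAt).congr_fderiv ?_
  ext z
  simp

namespace Matrix

open scoped Matrix.Norms.Operator in
/-- After changing their diagonals, two square matrices are simultaneously diagonalized by
`X * _ * Y`, with prescribed distinct ratios of eigenvalues. -/
theorem exists_simultaneous_diagonalization_modulo_diagonal {𝕜 ι : Type*} [RCLike 𝕜] [Fintype ι]
    [DecidableEq ι] {l : ι → 𝕜} (hl : Function.Injective l) (B C : Matrix ι ι 𝕜) :
    ∃ (X Y : Matrix ι ι 𝕜) (d e : ι → 𝕜),
      B = X * Y + diagonal d ∧ C = X * diagonal l * Y + diagonal e := by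
  let S₁ : Matrix ι ι 𝕜 × Matrix ι ι 𝕜 →ₗ[𝕜] Matrix ι ι 𝕜 :=
    { toFun := fun z ↦ of fun i j ↦ (l j - l i)⁻¹ * (z.2 i j - l i * z.1 i j)
      map_add' := fun z w ↦ by ext i j; simp; ring
      map_smul' := fun a z ↦ by ext i j; simp; ring }
  let S₂ : Matrix ι ι 𝕜 × Matrix ι ι 𝕜 →ₗ[𝕜] Matrix ι ι 𝕜 :=
    { toFun := fun z ↦ of fun i j ↦ (l j - l i)⁻¹ * (l j * z.1 i j - z.2 i j)
      map_add' := fun z w ↦ by ext i j; simp; ring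
      map_smul' := fun a z ↦ by ext i j; simp; ring }
  let Q : Matrix ι ι 𝕜 × Matrix ι ι 𝕜 → Matrix ι ι 𝕜 × Matrix ι ι 𝕜 :=
    fun z ↦ (S₁ z * S₂ z, S₁ z * diagonal l * S₂ z)
  have hQ0 : Q 0 = 0 := by simp [Q]
  have hQ : HasStrictFDerivAt Q
      (0 : Matrix ι ι 𝕜 × Matrix ι ι 𝕜 →L[𝕜] Matrix ι ι 𝕜 × Matrix ι ι 𝕜) 0 := by
    have h₁ := hasStrictFDerivAt_zero_mul (LinearMap.toContinuousLinearMap S₁)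
      (LinearMap.toContinuousLinearMap S₂)
    have h₂ := hasStrictFDerivAt_zero_mul
      (LinearMap.toContinuousLinearMap (LinearMap.mulRight 𝕜 (diagonal l) ∘ₗ S₁))
      (LinearMap.toContinuousLinearMap S₂)
    exact h₁.prodMk h₂
  obtain ⟨ε, z, hε, hz⟩ := exists_smul_eq_add_of_hasStrictFDerivAt_zero hQ0 hQ (B, C)
  have hz₁ : z.1 + S₁ z * S₂ z = ε • B := congrArg Prod.fst hz
  have hz₂ : z.2 + S₁ z * diagonal l * S₂ z = ε • C := congrArg Prod.snd hz
  let X := ε⁻¹ • (1 + S₁ z)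
  let Y := 1 + S₂ z
  have hoff : ∀ i j, i ≠ j → B i j = (X * Y) i j ∧ C i j = (X * diagonal l * Y) i j := by
    intro i j hij
    have hlij : l j - l i ≠ 0 := sub_ne_zero.2 (hl.ne hij.symm)
    have e₁ := congrFun (congrFun hz₁ i) j
    have e₂ := congrFun (congrFun hz₂ i) j
    simp only [add_apply, smul_apply, smul_eq_mul] at e₁ e₂
    have s₁ : S₁ z i j = (l j - l i)⁻¹ * (z.2 i j - l i * z.1 i j) := rfl
    have s₂ : S₂ z i j = (l j - l i)⁻¹ * (l j * z.1 i j - z.2 i j) := rfl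
    have t₁ : S₁ z i j + S₂ z i j = z.1 i j := by
      rw [s₁, s₂]; field_simp; ring
    have t₂ : S₁ z i j * l j + l i * S₂ z i j = z.2 i j := by
      rw [s₁, s₂]; field_simp; ring
    constructor
    · simp only [X, Y, smul_mul, add_mul, mul_add, one_mul, mul_one, smul_apply, add_apply,
        one_apply_ne hij, smul_eq_mul]
      linear_combination -(inv_mul_cancel_left₀ hε (B i j)) - ε⁻¹ * e₁ - ε⁻¹ * t₁
    · simp only [X, Y, smul_mul, add_mul, mul_add, one_mul, mul_one, smul_apply, add_apply,
        diagonal_apply_ne _ hij, smul_eq_mul, mul_diagonal, diagonal_mul]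
      linear_combination -(inv_mul_cancel_left₀ hε (C i j)) - ε⁻¹ * e₂ - ε⁻¹ * t₂
  refine ⟨X, Y, fun i ↦ B i i - (X * Y) i i, fun i ↦ C i i - (X * diagonal l * Y) i i, ?_, ?_⟩
  · ext i j
    obtain rfl | hij := eq_or_ne i j
    · simp
    · simp [diagonal_apply_ne _ hij, (hoff i j hij).1]
  · ext i j
    obtain rfl | hij := eq_or_ne i j
    · simp
    · simp [diagonal_apply_ne _ hij, (hoff i j hij).2]

/-- A matrix with at least as many columns as rows is equivalent to a diagonal block followed by
a zero block. -/
theorem exists_eq_mul_fromCols_diagonal_mul {K α β γ : Type*} [Field K] [Fintype α] [Fintype β]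
    [Fintype γ] [DecidableEq α] [DecidableEq β] [DecidableEq γ]
    (h : Fintype.card β = Fintype.card α + Fintype.card γ) (A : Matrix α β K) :
    ∃ (U U' : Matrix α α K) (V : Matrix (α ⊕ γ) β K) (V' : Matrix β (α ⊕ γ) K) (d : α → K),
      U * U' = 1 ∧ V' * V = 1 ∧ A = U * fromCols (diagonal d) (0 : Matrix α γ K) * V := by
  have hker : Fintype.card γ ≤ Module.finrank K (LinearMap.ker A.mulVecLin) := by
    have h₁ := A.mulVecLin.finrank_range_add_finrank_ker
    have h₂ := Submodule.finrank_le (LinearMap.range A.mulVecLin)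
    rw [Module.finrank_pi] at h₁ h₂
    lia
  obtain ⟨f, hf⟩ := exists_linearIndependent_of_le_finrank hker
  have hg : LinearIndependent K fun c : γ ↦ (f (Fintype.equivFin γ c) : β → K) :=
    (hf.map' _ (Submodule.ker_subtype _)).comp _ (Fintype.equivFin γ).injective
  let b₀ := Module.Basis.sumExtend hg
  have hfin : Finite (γ ⊕ Module.Basis.sumExtendIndex hg) := Module.Finite.finite_basis b₀
  have : Finite (Module.Basis.sumExtendIndex hg) := Finite.sum_right γ
  have hcard : Nat.card (Module.Basis.sumExtendIndex hg) = Nat.card α := by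
    have h₁ := Module.finrank_eq_nat_card_basis b₀
    rw [Module.finrank_pi, Nat.card_sum, Nat.card_eq_fintype_card (α := γ)] at h₁
    rw [Nat.card_eq_fintype_card (α := α)]
    lia
  let b := b₀.reindex (((Equiv.refl γ).sumCongr (Finite.card_eq.1 hcard).some).trans
    (Equiv.sumComm γ α))
  have hb (c : γ) : A.mulVec (b (Sum.inr c)) = 0 := by
    have h₁ : b (Sum.inr c) = f (Fintype.equivFin γ c) := by
      simp only [b, b₀, Module.Basis.sumExtend, Module.Basis.reindex_apply,
        Module.Basis.extend_apply_self]
      rfl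
    rw [h₁]
    exact (f (Fintype.equivFin γ c)).2
  let W := (Pi.basisFun K β).toMatrix b
  let W' := b.toMatrix (Pi.basisFun K β)
  have hW : W * W' = 1 := Module.Basis.toMatrix_mul_toMatrix_flip _ _
  let T := (A * W).toCols₁
  have hT : A * W = fromCols T (0 : Matrix α γ K) := by
    ext i (j | j)
    · rfl
    · exact congrFun (hb j) i
  obtain ⟨L, L', d, hd⟩ :=
    Pivot.exists_list_transvec_mul_mul_list_transvec_eq_diagonal T
  set P := (L.map TransvectionStruct.toMatrix).prod
  set P' := (L'.map TransvectionStruct.toMatrix).prod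
  have hP : IsUnit P.det := by simp [P]
  have hP' : IsUnit P'.det := by simp [P']
  let G : Matrix (α ⊕ γ) (α ⊕ γ) K := fromBlocks P' 0 0 1
  let G' : Matrix (α ⊕ γ) (α ⊕ γ) K := fromBlocks P'⁻¹ 0 0 1
  have hG : G * G' = 1 := by simp [G, G', fromBlocks_multiply, mul_nonsing_inv _ hP']
  refine ⟨P⁻¹, P, G' * W', W * G, d,
    nonsing_inv_mul _ hP, ?_, ?_⟩
  · rw [Matrix.mul_assoc, ← Matrix.mul_assoc G, hG, Matrix.one_mul, hW]
  · have hTd : P⁻¹ * diagonal d * P'⁻¹ = T := by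
      rw [← hd, Matrix.mul_assoc P, nonsing_inv_mul_cancel_left _ _ hP,
        mul_nonsing_inv_cancel_right _ _ hP']
    rw [← Matrix.mul_assoc, mul_fromCols, fromCols_mul_fromBlocks]
    simp [hTd, ← hT, Matrix.mul_assoc, hW]

end Matrix

/-- A decomposition into rank-one terms indexed by `R` bounds the tensor rank. -/
theorem tensorRank_le_card {𝔽 α β κ R : Type*} [Field 𝔽] [Fintype α] [Fintype β] [Fintype κ]
    [Fintype R] {A : κ → Matrix α β 𝔽} (a : R → α → 𝔽) (b : R → β → 𝔽) (c : R → κ → 𝔽)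
    (h : ∀ k, A k = ∑ i, c i k • Matrix.vecMulVec (a i) (b i)) :
    tensorRank 𝔽 A ≤ Fintype.card R := by
  let e := (Fintype.equivFin R).symm
  refine Nat.sInf_le ⟨a ∘ e, b ∘ e, c ∘ e, fun k ↦ ?_⟩
  rw [h k]
  exact (e.sum_comp fun i ↦ c i k • Matrix.vecMulVec (a i) (b i)).symm

/-- Tensors with a diagonal slice, followed by pairs of arbitrary slices. -/
theorem exists_decomposition_of_diagonal_slice {𝔽 α γ κ : Type*} [RCLike 𝔽] [Fintype α]
    [Fintype γ] [Fintype κ] [DecidableEq α] [DecidableEq γ] [DecidableEq κ]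
    (d : α → 𝔽) (N : κ × Bool → Matrix α (α ⊕ γ) 𝔽) :
    ∃ (a : α ⊕ κ × (α ⊕ γ) → α → 𝔽) (b : α ⊕ κ × (α ⊕ γ) → α ⊕ γ → 𝔽)
      (c : α ⊕ κ × (α ⊕ γ) → Option (κ × Bool) → 𝔽),
      Matrix.fromCols (Matrix.diagonal d) (0 : Matrix α γ 𝔽) =
        ∑ i, c i none • Matrix.vecMulVec (a i) (b i) ∧
      ∀ k, N k = ∑ i, c i (some k) • Matrix.vecMulVec (a i) (b i) := by
  obtain ⟨l, hl⟩ : ∃ l : α ⊕ γ → 𝔽, Function.Injective l :=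
    ⟨fun i ↦ (Fintype.equivFin (α ⊕ γ) i : ℕ), Nat.cast_injective.comp
      (Fin.val_injective.comp (Fintype.equivFin _).injective)⟩
  choose X Y p q hp hq using fun k : κ ↦
    Matrix.exists_simultaneous_diagonalization_modulo_diagonal hl
      (Matrix.fromRows (N (k, false)) 0) (Matrix.fromRows (N (k, true)) 0)
  refine ⟨Sum.elim (fun i ↦ Pi.single i 1) fun s i ↦ X s.1 (Sum.inl i) s.2,
    Sum.elim (fun i ↦ Pi.single (Sum.inl i) 1) fun s ↦ Y s.1 s.2,
    Sum.elim (fun i o ↦ o.elim (d i) fun k ↦ if k.2 then q k.1 (Sum.inl i) else p k.1 (Sum.inl i))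
      fun s o ↦ o.elim 0 fun k ↦ if k.1 = s.1 then (if k.2 then l s.2 else 1) else 0, ?_, ?_⟩
  · ext i (j | j)
    · obtain rfl | hij := eq_or_ne i j
      · simp [Matrix.sum_apply, Matrix.vecMulVec_apply, Pi.single_apply]
      · simp [Matrix.sum_apply, Matrix.vecMulVec_apply, Pi.single_apply, hij]
    · simp [Matrix.sum_apply, Matrix.vecMulVec_apply, Pi.single_apply]
  · have hdiag (v : α ⊕ γ → 𝔽) (i : α) (j : α ⊕ γ) :
        (∑ x, if j = Sum.inl x then if i = x then v (Sum.inl x) else 0 else 0) =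
          if Sum.inl i = j then v (Sum.inl i) else 0 := by
      rcases j with j | j
      · obtain rfl | hij := eq_or_ne i j
        · simp
        · simp [hij]
      · simp
    rintro ⟨k, _ | _⟩ <;> ext i j
    · have h := congrFun (congrFun (hp k) (Sum.inl i)) j
      rw [Matrix.fromRows_apply_inl] at h
      rw [h]
      simp [Matrix.sum_apply, Matrix.vecMulVec_apply, Matrix.diagonal_apply, Pi.single_apply,
        Fintype.sum_prod_type, Matrix.mul_apply]
      rw [hdiag, add_comm]
    · have h := congrFun (congrFun (hq k) (Sum.inl i)) j
      rw [Matrix.fromRows_apply_inl] at h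
      rw [h]
      simp [Matrix.sum_apply, Matrix.vecMulVec_apply, Matrix.diagonal_apply, Pi.single_apply,
        Fintype.sum_prod_type, Matrix.mul_apply]
      rw [hdiag, add_comm]
      simp only [mul_assoc, mul_left_comm (l _)]

/-- An `α × β` tensor with `|α| ≤ |β|` and slices indexed by `Option (κ × Bool)` has rank at most
`|α| + |κ| * |β|`. -/
theorem tensorRank_option_prod_bool_le {𝔽 α β κ : Type*} [RCLike 𝔽] [Fintype α] [Fintype β]
    [Fintype κ] (h : Fintype.card α ≤ Fintype.card β) (A : Option (κ × Bool) → Matrix α β 𝔽) :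
    tensorRank 𝔽 A ≤ Fintype.card α + Fintype.card κ * Fintype.card β := by
  classical
  let γ := Fin (Fintype.card β - Fintype.card α)
  have hcard : Fintype.card β = Fintype.card α + Fintype.card γ := by simp [γ]; lia
  obtain ⟨U, U', V, V', d, hU, hV, hA⟩ :=
    Matrix.exists_eq_mul_fromCols_diagonal_mul hcard (A none)
  obtain ⟨a, b, c, h₀, h₁⟩ := exists_decomposition_of_diagonal_slice d
    fun k ↦ U' * A (some k) * V'
  have hsum (k : Option (κ × Bool)) :
      U * (∑ i, c i k • Matrix.vecMulVec (a i) (b i)) * V =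
        ∑ i, c i k • Matrix.vecMulVec (U.mulVec (a i)) (Matrix.vecMul (b i) V) := by
    simp only [Matrix.mul_sum, Matrix.sum_mul, Matrix.mul_smul, Matrix.smul_mul,
      Matrix.mul_vecMulVec, Matrix.vecMulVec_mul]
  refine (tensorRank_le_card (fun i ↦ U.mulVec (a i)) (fun i ↦ Matrix.vecMul (b i) V) c
    fun k ↦ ?_).trans_eq (by simp [hcard])
  rw [← hsum]
  cases k with
  | none => rw [← h₀, hA]
  | some k =>
    rw [← h₁, Matrix.mul_assoc U, Matrix.mul_assoc (U' * _), hV, Matrix.mul_one,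
      ← Matrix.mul_assoc, hU, Matrix.one_mul]

/-- Reindexing the slices along a bijection preserves the tensor rank. -/
theorem tensorRank_comp_equiv {𝔽 α β κ κ' : Type*} [Field 𝔽] [Fintype α] [Fintype β] [Fintype κ]
    [Fintype κ'] (e : κ' ≃ κ) (A : κ → Matrix α β 𝔽) :
    tensorRank 𝔽 (A ∘ e) = tensorRank 𝔽 A := by
  unfold tensorRank
  congr 1 with r
  constructor
  · rintro ⟨a, b, c, h⟩
    exact ⟨a, b, fun i ↦ c i ∘ e.symm, fun k ↦ by simpa using h (e.symm k)⟩
  · rintro ⟨a, b, c, h⟩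
    exact ⟨a, b, fun i ↦ c i ∘ e, fun k ↦ h (e k)⟩

/-- If `𝔽` is `ℝ` or `ℂ`, `n ≤ m` and `p` is odd, then
`maxRank 𝔽 n m p ≤ n + m * (p - 1) / 2`. -/
theorem stmt4 {𝔽 : Type*} [RCLike 𝔽] {n m p : ℕ}
    (hn : 0 < n) (hp : 0 < p) (hnm : n ≤ m) (hodd : Odd p) :
    maxRank 𝔽 n m p ≤ n + m * (p - 1) / 2 := by
  obtain ⟨k, rfl⟩ := hodd
  refine csSup_le' ?_
  rintro _ ⟨A, rfl⟩
  have e : Fin (2 * k + 1) ≃ Option (Fin k × Bool) :=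
    Fintype.equivOfCardEq (by simp [mul_comm])
  have h := tensorRank_option_prod_bool_le (α := Fin n) (β := Fin m) (by simpa using hnm)
    (A ∘ e.symm)
  rw [tensorRank_comp_equiv] at h
  have hk : m * (2 * k + 1 - 1) / 2 = k * m := by
    rw [Nat.add_sub_cancel, show m * (2 * k) = k * m * 2 by ring, Nat.mul_div_cancel _ two_pos]
  rw [hk]
  simpa using h
end

section
/- Let 𝔽 be ℝ or ℂ and let m, n, k be positive integers with k ≤ n. Then max.rank_𝔽(m, n, mn−k) = m(n−k) + max.rank_𝔽(m, k, mk−k). -/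
section

open Module Submodule

variable {F : Type*} [Field F]

/-- `CoveredBy V r`: at most `r` matrices of the form `a bᵀ` span a space containing `V`. -/
def CoveredBy {α β : Type*} (V : Submodule F (Matrix α β F)) (r : ℕ) : Prop :=
  ∃ s : Finset (Matrix α β F), s.card ≤ r ∧ (∀ M ∈ s, ∃ a b, M = Matrix.vecMulVec a b) ∧
    V ≤ span F (s : Set (Matrix α β F))

theorem finrank_map_add_finrank_ker_inf {E E' : Type*} [AddCommGroup E] [Module F E]
    [FiniteDimensional F E] [AddCommGroup E'] [Module F E'] (f : E →ₗ[F] E')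
    (U : Submodule F E) :
    finrank F (U.map f) + finrank F (LinearMap.ker f ⊓ U : Submodule F E) = finrank F U := by
  rw [← (f.domRestrict U).finrank_range_add_finrank_ker, LinearMap.range_domRestrict,
    LinearMap.ker_domRestrict, inf_comm, ← map_comap_subtype,
    finrank_map_subtype_eq]

theorem exists_le_finrank_eq {E : Type*} [AddCommGroup E] [Module F E]
    [FiniteDimensional F E] (U : Submodule F E) {k : ℕ} (hU : finrank F U ≤ k)
    (hk : k ≤ finrank F E) : ∃ U' : Submodule F E, U ≤ U' ∧ finrank F U' = k := by
  induction k, hU using Nat.le_induction with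
  | base => exact ⟨U, le_rfl, rfl⟩
  | succ k _ ih =>
    obtain ⟨W, hUW, hW⟩ := ih (by omega)
    have hne : W ≠ ⊤ := by
      rintro rfl
      rw [finrank_top] at hW
      omega
    obtain ⟨x, -, hx⟩ := SetLike.exists_of_lt hne.lt_top
    refine ⟨W ⊔ span F {x}, hUW.trans le_sup_left, ?_⟩
    rw [finrank_sup_span_singleton hx, hW]

theorem exists_finset_subset_sup_span_eq {E : Type*} [AddCommGroup E] [Module F E]
    [FiniteDimensional F E] (W : Submodule F E) (S : Set E) :
    ∃ t : Finset E, (t : Set E) ⊆ S ∧ W ⊔ span F (t : Set E) = W ⊔ span F S ∧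
      t.card + finrank F W = finrank F (W ⊔ span F S : Submodule F E) := by
  classical
  obtain ⟨κ, a, ha, hspan, hli⟩ := exists_linearIndependent' F (fun x : S => W.mkQ x)
  have : Finite κ := hli.finite
  have := Fintype.ofFinite κ
  have hinj : Function.Injective fun i => (a i : E) := Subtype.val_injective.comp ha
  have hS : span F (Set.range fun x : S => W.mkQ x) = (span F S).map W.mkQ := by
    rw [map_span]; congr 1; ext; simp
  have ht : span F (Set.range ((fun x : S => W.mkQ x) ∘ a)) =
      (span F (Set.range fun i => (a i : E))).map W.mkQ := by
    rw [map_span, ← Set.range_comp]; rfl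
  have hsup : W ⊔ span F (Set.range fun i => (a i : E)) = W ⊔ span F S := by
    have := congrArg (comap W.mkQ) (ht.symm.trans (hspan.trans hS))
    simpa [comap_map_mkQ] using this
  refine ⟨Finset.univ.image fun i => (a i : E), ?_, ?_, ?_⟩
  · intro x; simp only [Finset.coe_image, Finset.coe_univ, Set.image_univ]
    rintro ⟨i, rfl⟩; exact (a i).2
  · simpa using hsup
  · rw [Finset.card_image_of_injective _ hinj, Finset.card_univ, ← finrank_span_eq_card hli, hspan, hS]
    have h := finrank_map_add_finrank_ker_inf W.mkQ (W ⊔ span F S)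
    rw [Submodule.map_sup] at h
    have h1 : W.map W.mkQ = ⊥ := by simp
    rw [h1, bot_sup_eq] at h
    rwa [ker_mkQ, inf_eq_left.2 le_sup_left] at h

theorem CoveredBy.map {α β γ : Type*} {V : Submodule F (Matrix α β F)} {r : ℕ}
    (h : CoveredBy V r) (f : Matrix α β F →ₗ[F] Matrix α γ F)
    (hf : ∀ a b, ∃ a' b', f (Matrix.vecMulVec a b) = Matrix.vecMulVec a' b') :
    CoveredBy (V.map f) r := by
  classical
  obtain ⟨s, hs, h1, hV⟩ := h
  refine ⟨s.image f, Finset.card_image_le.trans hs, ?_, ?_⟩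
  · intro M hM
    obtain ⟨N, hN, rfl⟩ := Finset.mem_image.1 hM
    obtain ⟨a, b, rfl⟩ := h1 N hN
    exact hf a b
  · rw [Finset.coe_image, ← map_span]
    exact map_mono hV

theorem coveredBy_card {m n : ℕ} (V : Submodule F (Matrix (Fin m) (Fin n) F)) :
    CoveredBy V (m * n) := by
  classical
  refine ⟨Finset.univ.image fun p : Fin m × Fin n => Matrix.single p.1 p.2 1,
    Finset.card_image_le.trans (by simp), ?_, ?_⟩
  · intro M hM
    obtain ⟨p, -, rfl⟩ := Finset.mem_image.1 hM
    exact ⟨Pi.single p.1 1, Pi.single p.2 1, Matrix.single_eq_single_vecMulVec_single _ _⟩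
  · intro M _
    rw [Matrix.matrix_eq_sum_single M]
    refine sum_mem fun i _ => sum_mem fun j _ => ?_
    have : Matrix.single i j (M i j) = M i j • Matrix.single i j (1 : F) := by simp
    rw [this]
    exact smul_mem _ _ (subset_span (by simp))

theorem tensorRank_le_iff {m n p r : ℕ} (A : Fin p → Matrix (Fin m) (Fin n) F) :
    tensorRank F A ≤ r ↔ CoveredBy (span F (Set.range A)) r := by
  classical
  have key : ∀ q, CoveredBy (span F (Set.range A)) q → ∃ r ≤ q, ∃ (a : Fin r → Fin m → F)
      (b : Fin r → Fin n → F) (c : Fin r → Fin p → F),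
      ∀ k, A k = ∑ i, c i k • Matrix.vecMulVec (a i) (b i) := by
    rintro q ⟨s, hs, h1, hV⟩
    choose! a b hab using h1
    refine ⟨s.card, hs, fun i => a (s.equivFin.symm i), fun i => b (s.equivFin.symm i), ?_⟩
    have h2 : ∀ k, ∃ c : Fin s.card → F, ∑ i, c i • (s.equivFin.symm i : Matrix _ _ F) = A k := by
      intro k
      have : A k ∈ span F (Set.range fun i => (s.equivFin.symm i : Matrix (Fin m) (Fin n) F)) := by
        convert hV (subset_span (Set.mem_range_self k)) using 2
        ext x
        rw [Set.mem_range, Finset.mem_coe, iff_comm]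
        exact ⟨fun hx => ⟨s.equivFin ⟨x, hx⟩, by simp⟩,
          by rintro ⟨i, rfl⟩; exact (s.equivFin.symm i).2⟩
      exact (mem_span_range_iff_exists_fun F).1 this
    choose c hc using h2
    refine ⟨fun i k => c k i, fun k => ?_⟩
    rw [← hc k]
    exact Finset.sum_congr rfl fun i _ => by rw [← hab _ (s.equivFin.symm i).2]
  constructor
  · intro h
    obtain ⟨r₀, -, hr₀⟩ := key _ (coveredBy_card _)
    obtain ⟨a, b, c, hA⟩ : ∃ (a : Fin (tensorRank F A) → Fin m → F)
        (b : Fin (tensorRank F A) → Fin n → F) (c : Fin (tensorRank F A) → Fin p → F),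
        ∀ k, A k = ∑ i, c i k • Matrix.vecMulVec (a i) (b i) :=
      Nat.sInf_mem (s := {r : ℕ | ∃ (a : Fin r → Fin m → F) (b : Fin r → Fin n → F)
        (c : Fin r → Fin p → F), ∀ k, A k = ∑ i, c i k • Matrix.vecMulVec (a i) (b i)}) ⟨r₀, hr₀⟩
    refine ⟨Finset.univ.image fun i => Matrix.vecMulVec (a i) (b i),
      (Finset.card_image_le.trans (by simp)).trans h, ?_, ?_⟩
    · intro M hM
      obtain ⟨i, -, rfl⟩ := Finset.mem_image.1 hM
      exact ⟨_, _, rfl⟩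
    · rw [span_le]
      rintro _ ⟨k, rfl⟩
      rw [SetLike.mem_coe, hA k]
      exact sum_mem fun i _ => smul_mem _ _ (subset_span (by simp))
  · intro h
    obtain ⟨q, hq, h⟩ := key _ h
    exact (Nat.sInf_le h).trans hq

theorem maxRank_le_iff {m n p r : ℕ} :
    maxRank F m n p ≤ r ↔
      ∀ V : Submodule F (Matrix (Fin m) (Fin n) F), finrank F V ≤ p → CoveredBy V r := by
  have hbdd : BddAbove {r : ℕ | ∃ A : Fin p → Matrix (Fin m) (Fin n) F, tensorRank F A = r} := by
    refine ⟨m * n, ?_⟩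
    rintro _ ⟨A, rfl⟩
    exact (tensorRank_le_iff A).2 (coveredBy_card _)
  constructor
  · intro h V hV
    obtain ⟨A, hA⟩ : ∃ A : Fin p → Matrix (Fin m) (Fin n) F, V ≤ span F (Set.range A) := by
      let b := finBasis F V
      refine ⟨fun i => if hi : i < finrank F V then b ⟨i, hi⟩ else 0, ?_⟩
      calc V = (⊤ : Submodule F V).map V.subtype := by simp
        _ ≤ _ := by
          rw [← b.span_eq, map_span, span_le]
          rintro _ ⟨_, ⟨i, rfl⟩, rfl⟩
          exact subset_span ⟨⟨i, i.2.trans_le hV⟩, by simp⟩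
    obtain ⟨s, hs, h1, h2⟩ := (tensorRank_le_iff A).1 ((le_csSup hbdd ⟨A, rfl⟩).trans h)
    exact ⟨s, hs, h1, hA.trans h2⟩
  · intro h
    refine csSup_le ⟨_, 0, rfl⟩ ?_
    rintro _ ⟨A, rfl⟩
    exact (tensorRank_le_iff A).2 (h _ ((finrank_range_le_card A).trans (by simp)))

theorem add_maxRank_le_maxRank {m n k : ℕ} (hm : 0 < m) (hkn : k ≤ n) :
    m * (n - k) + maxRank F m k (m * k - k) ≤ maxRank F m n (m * n - k) := by
  classical
  let π : Matrix (Fin m) (Fin n) F →ₗ[F] Matrix (Fin m) (Fin k) F :=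
    LinearMap.compLeft (LinearMap.funLeft F F (Fin.castLE hkn)) (Fin m)
  have hπ : Function.Surjective π :=
    (LinearMap.funLeft_surjective_of_injective F F _ (Fin.castLE_injective hkn)).comp_left
  have hker : finrank F (LinearMap.ker π) + m * k = m * n := by
    have := π.finrank_range_add_finrank_ker
    rw [LinearMap.range_eq_top.2 hπ] at this
    simp [finrank_matrix] at this
    omega
  have hmk : k ≤ m * k := Nat.le_mul_of_pos_left k hm
  have hsub : m * (n - k) = m * n - m * k := Nat.mul_sub _ _ _
  have key : ∀ V : Submodule F (Matrix (Fin m) (Fin k) F), finrank F V ≤ m * k - k →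
      ∃ r, r + m * (n - k) ≤ maxRank F m n (m * n - k) ∧ CoveredBy V r := by
    intro V hV
    have hdim : finrank F (V.comap π) = finrank F V + finrank F (LinearMap.ker π) := by
      rw [← finrank_map_add_finrank_ker_inf π, map_comap_eq_of_surjective hπ,
        inf_eq_left.2 (LinearMap.ker_le_comap π)]
    obtain ⟨s, hs, h1, hVs⟩ := maxRank_le_iff.1 (le_refl (maxRank F m n (m * n - k)))
      (V.comap π) (by rw [hdim]; omega)
    have hks : LinearMap.ker π ≤ span F (s : Set (Matrix (Fin m) (Fin n) F)) :=
      (LinearMap.ker_le_comap π).trans hVs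
    obtain ⟨t, hts, hsup, hcard⟩ := exists_finset_subset_sup_span_eq (LinearMap.ker π) (s : Set _)
    rw [sup_eq_right.2 hks] at hsup hcard
    refine ⟨t.card, ?_, ?_⟩
    · have : finrank F (span F (s : Set (Matrix (Fin m) (Fin n) F))) ≤ s.card :=
        finrank_span_finset_le_card s
      omega
    have hV' : V ≤ (span F (t : Set (Matrix (Fin m) (Fin n) F))).map π := by
      rw [← map_comap_eq_of_surjective hπ V]
      refine (map_mono (hVs.trans hsup.ge)).trans ?_
      rw [Submodule.map_sup, (LinearMap.le_ker_iff_map).1 le_rfl, bot_sup_eq]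
    obtain ⟨u, hu, h2, h3⟩ := CoveredBy.map (V := span F (t : Set (Matrix (Fin m) (Fin n) F)))
      ⟨t, le_rfl, fun M hM => h1 M (hts hM), le_rfl⟩ π
      fun a b => ⟨a, b ∘ Fin.castLE hkn, rfl⟩
    exact ⟨u, hu, h2, hV'.trans h3⟩
  obtain ⟨r₀, h₀, -⟩ := key ⊥ (by simp)
  have : maxRank F m k (m * k - k) ≤ maxRank F m n (m * n - k) - m * (n - k) := by
    refine maxRank_le_iff.2 fun V hV => ?_
    obtain ⟨r, hr, s, hs, h⟩ := key V hV
    exact ⟨s, by omega, h⟩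
  omega

theorem exists_ne_zero_finrank_range_le_add_smul {𝔽 A Q : Type*} [RCLike 𝔽] [AddCommGroup A]
    [Module 𝔽 A] [AddCommGroup Q] [Module 𝔽 Q] [FiniteDimensional 𝔽 Q] (f g : A →ₗ[𝔽] Q) :
    ∃ t : 𝔽, t ≠ 0 ∧
      finrank 𝔽 (LinearMap.range f) ≤ finrank 𝔽 (LinearMap.range (f + t • g)) := by
  let e := (finBasis 𝔽 Q).equivFun
  let b := finBasis 𝔽 (LinearMap.range f)
  choose u hu using fun i => (b i).2
  have hli : LinearIndependent 𝔽 fun i => e (f (u i)) := by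
    simp only [hu]
    exact (b.linearIndependent.map' _ (ker_subtype _)).map' e.toLinearMap e.ker
  have hev : ∀ᶠ t in nhds (0 : 𝔽), LinearIndependent 𝔽 fun i => e (f (u i)) + t • e (g (u i)) := by
    have hc : Continuous fun (t : 𝔽) i => e (f (u i)) + t • e (g (u i)) := by fun_prop
    refine hc.continuousAt.eventually (p := fun v => LinearIndependent 𝔽 v) ?_
    exact LinearIndependent.eventually (by simpa using hli)
  obtain ⟨t, ht, ht0⟩ :=
    ((hev.filter_mono nhdsWithin_le_nhds).and (self_mem_nhdsWithin (s := {0}ᶜ))).exists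
  refine ⟨t, ht0, ?_⟩
  have hli' : LinearIndependent 𝔽 fun i => (f + t • g) (u i) := by
    refine LinearIndependent.of_comp e.toLinearMap ?_
    convert ht using 2 with i
    simp
  calc finrank 𝔽 (LinearMap.range f)
      = finrank 𝔽 (span 𝔽 (Set.range fun i => (f + t • g) (u i))) := by
        rw [finrank_span_eq_card hli', Fintype.card_fin]
    _ ≤ _ := finrank_mono <| by
        rw [span_le]
        rintro _ ⟨i, rfl⟩
        exact ⟨_, rfl⟩

/-- A space `V` of matrices of codimension `k` has a `k`-dimensional space of row vectors such that
the matrices with these rows, together with the matrices of rank at most one in `V`, span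
everything. -/
theorem exists_injective_span_sup_range_eq_top {𝔽 : Type*} [RCLike 𝔽] {m n k : ℕ} (hkn : k ≤ n)
    (V : Submodule 𝔽 (Matrix (Fin m) (Fin n) 𝔽))
    (hV : finrank 𝔽 (Matrix (Fin m) (Fin n) 𝔽 ⧸ V) = k) :
    ∃ e : (Fin k → 𝔽) →ₗ[𝔽] (Fin n → 𝔽), Function.Injective e ∧
      span 𝔽 {M | M ∈ V ∧ ∃ a b, M = Matrix.vecMulVec a b} ⊔
        LinearMap.range (e.compLeft (Fin m)) = ⊤ := by
  let φ : (Fin m → 𝔽) →ₗ[𝔽] (Fin n → 𝔽) →ₗ[𝔽] (Matrix (Fin m) (Fin n) 𝔽 ⧸ V) :=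
    (vecMulVecBilin 𝔽 𝔽).compr₂ V.mkQ
  have hφ : ∀ x y, φ x y = V.mkQ (Matrix.vecMulVec x y) := fun _ _ => rfl
  have hle : ∀ x, finrank 𝔽 (LinearMap.range (φ x)) ≤ k := fun x => hV ▸ finrank_le _
  obtain ⟨x₀, hx₀⟩ : ∃ x₀, ∀ x, finrank 𝔽 (LinearMap.range (φ x)) ≤
      finrank 𝔽 (LinearMap.range (φ x₀)) := by
    have hbdd : BddAbove (Set.range fun x => finrank 𝔽 (LinearMap.range (φ x))) :=
      ⟨k, by rintro _ ⟨x, rfl⟩; exact hle x⟩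
    obtain ⟨x₀, h⟩ := Nat.sSup_mem (Set.range_nonempty _) hbdd
    exact ⟨x₀, fun x => (le_csSup hbdd ⟨x, rfl⟩).trans h.ge⟩
  obtain ⟨C, hC⟩ := Submodule.exists_isCompl (LinearMap.ker (φ x₀))
  have hCk : finrank 𝔽 C ≤ k := by
    have h1 := finrank_add_eq_of_isCompl hC
    have h2 := (φ x₀).finrank_range_add_finrank_ker
    have := hle x₀
    omega
  obtain ⟨U, hCU, hU⟩ := exists_le_finrank_eq C hCk (by simpa using hkn)
  let e : (Fin k → 𝔽) →ₗ[𝔽] (Fin n → 𝔽) :=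
    U.subtype ∘ₗ (LinearEquiv.ofFinrankEq (Fin k → 𝔽) U (by simp [hU])).toLinearMap
  have he : LinearMap.range e = U := by simp [e, LinearMap.range_comp]
  refine ⟨e, U.injective_subtype.comp (LinearEquiv.injective _), ?_⟩
  set T := span 𝔽 {M | M ∈ V ∧ ∃ a b, M = Matrix.vecMulVec a b} ⊔
        LinearMap.range (e.compLeft (Fin m)) with hT
  let Φ : Matrix (Fin m) (Fin k) 𝔽 →ₗ[𝔽] Matrix (Fin m) (Fin n) 𝔽 := e.compLeft (Fin m)
  have hgood : ∀ x, finrank 𝔽 (LinearMap.range (φ x₀)) ≤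
      finrank 𝔽 (LinearMap.range (φ x ∘ₗ e)) → ∀ y, Matrix.vecMulVec x y ∈ T := by
    intro x hx y
    have hrange : LinearMap.range (φ x ∘ₗ e) = LinearMap.range (φ x) :=
      eq_of_le_of_finrank_le (LinearMap.range_comp_le_range _ _) ((hx₀ x).trans hx)
    obtain ⟨c, hc⟩ : φ x y ∈ LinearMap.range (φ x ∘ₗ e) := hrange ▸ ⟨y, rfl⟩
    have hmem : Matrix.vecMulVec x (y - e c) ∈ V := by
      rw [← V.ker_mkQ, LinearMap.mem_ker, ← hφ, map_sub, sub_eq_zero]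
      exact hc.symm
    have hxy : Matrix.vecMulVec x y =
        Matrix.vecMulVec x (y - e c) + Φ (Matrix.vecMulVec x c) := by
      ext i j
      have : Φ (Matrix.vecMulVec x c) i = x i • e c := by
        rw [← map_smul]; rfl
      rw [Matrix.add_apply, this]
      simp [Matrix.vecMulVec_apply]
      ring
    rw [hxy]
    exact add_mem (mem_sup_left (subset_span ⟨hmem, _, _, rfl⟩)) (mem_sup_right ⟨_, rfl⟩)
  have h₀ : LinearMap.range (φ x₀ ∘ₗ e) = LinearMap.range (φ x₀) := by
    rw [LinearMap.range_comp, he]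
    refine le_antisymm LinearMap.map_le_range ?_
    rw [LinearMap.range_eq_map, ← hC.sup_eq_top, Submodule.map_sup,
      (LinearMap.le_ker_iff_map).1 le_rfl, bot_sup_eq]
    exact map_mono hCU
  have hall : ∀ z y, Matrix.vecMulVec z y ∈ T := by
    intro z y
    obtain ⟨t, ht0, ht⟩ := exists_ne_zero_finrank_range_le_add_smul (φ x₀ ∘ₗ e) (φ z ∘ₗ e)
    have h1 : Matrix.vecMulVec (x₀ + t • z) y ∈ T := by
      refine hgood _ ?_ y
      rw [h₀] at ht
      have : φ (x₀ + t • z) ∘ₗ e = φ x₀ ∘ₗ e + t • φ z ∘ₗ e := by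
        rw [map_add, map_smul, LinearMap.add_comp, LinearMap.smul_comp]
      rwa [this]
    have h2 := T.smul_mem t⁻¹ (T.sub_mem h1 (hgood x₀ (by rw [h₀]) y))
    convert h2 using 1
    ext i j
    simp [Matrix.vecMulVec_apply]
    field_simp
    ring
  obtain ⟨s, -, hs, hs'⟩ := coveredBy_card (⊤ : Submodule 𝔽 (Matrix (Fin m) (Fin n) 𝔽))
  refine eq_top_iff.2 (hs'.trans (span_le.2 fun M hM => ?_))
  obtain ⟨a, b, rfl⟩ := hs M hM
  exact hall a b

theorem maxRank_le_add_maxRank {𝔽 : Type*} [RCLike 𝔽] {m n k : ℕ} (hm : 0 < m) (hkn : k ≤ n) :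
    maxRank 𝔽 m n (m * n - k) ≤ m * (n - k) + maxRank 𝔽 m k (m * k - k) := by
  classical
  have hmk : k ≤ m * k := Nat.le_mul_of_pos_left k hm
  have hmn : m * k ≤ m * n := Nat.mul_le_mul_left m hkn
  have hsub : m * (n - k) = m * n - m * k := Nat.mul_sub _ _ _
  refine maxRank_le_iff.2 fun V₀ hV₀ => ?_
  obtain ⟨V, hle, hV⟩ := exists_le_finrank_eq V₀ hV₀ (by simp [finrank_matrix])
  have hdim : finrank 𝔽 (Matrix (Fin m) (Fin n) 𝔽) = m * n := by simp [finrank_matrix]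
  have hquot : finrank 𝔽 (Matrix (Fin m) (Fin n) 𝔽 ⧸ V) = k := by
    have := V.finrank_quotient_add_finrank
    omega
  obtain ⟨e, he, hsup⟩ := exists_injective_span_sup_range_eq_top hkn V hquot
  set R := {M | M ∈ V ∧ ∃ a b, M = Matrix.vecMulVec a b}
  have hRV : span 𝔽 R ≤ V := span_le.2 fun M hM => hM.1
  let Φ : Matrix (Fin m) (Fin k) 𝔽 →ₗ[𝔽] Matrix (Fin m) (Fin n) 𝔽 := e.compLeft (Fin m)
  have hΦ : Function.Injective Φ := he.comp_left
  have hWV : (V.comap Φ).map Φ ⊔ span 𝔽 R = V := by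
    rw [map_comap_eq, sup_comm, ← sup_inf_assoc_of_le _ hRV]
    exact (congrArg (· ⊓ V) hsup).trans (top_inf_eq V)
  have hWdim : finrank 𝔽 ((V.comap Φ).map Φ) = m * k - k := by
    have h1 := finrank_sup_add_finrank_inf_eq (LinearMap.range Φ) V
    have h2 : LinearMap.range Φ ⊔ V = ⊤ := by
      rw [eq_top_iff, ← hsup, sup_comm]
      exact sup_le_sup_left hRV _
    rw [h2, finrank_top, LinearMap.finrank_range_of_inj hΦ, hdim, hV] at h1
    rw [map_comap_eq]
    have h3 : finrank 𝔽 (Matrix (Fin m) (Fin k) 𝔽) = m * k := by simp [finrank_matrix]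
    omega
  obtain ⟨s, hs, hs1, hVs⟩ := CoveredBy.map
    (maxRank_le_iff.1 (le_refl (maxRank 𝔽 m k (m * k - k))) (V.comap Φ)
      (by rw [← hWdim, (equivMapOfInjective Φ hΦ _).finrank_eq])) Φ
    fun a b => ⟨a, e b, by
      ext i j
      exact congrFun (map_smul e (a i) b) j⟩
  obtain ⟨t, htR, ht, htc⟩ := exists_finset_subset_sup_span_eq ((V.comap Φ).map Φ) R
  rw [hWV] at ht htc
  refine ⟨s ∪ t, (Finset.card_union_le _ _).trans (by omega), ?_, ?_⟩
  · intro M hM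
    rcases Finset.mem_union.1 hM with h | h
    · exact hs1 M h
    · exact (htR h).2
  · rw [Finset.coe_union, span_union]
    exact hle.trans (ht.ge.trans (sup_le_sup_right hVs _))

end

/-- If `𝔽` is `ℝ` or `ℂ` and `k ≤ n`, then
`maxRank 𝔽 m n (m * n - k) = m * (n - k) + maxRank 𝔽 m k (m * k - k)`. -/
theorem stmt7 {𝔽 : Type*} [RCLike 𝔽] {m n k : ℕ}
    (hm : 0 < m) (hn : 0 < n) (hk : 0 < k) (hkn : k ≤ n) :
    maxRank 𝔽 m n (m * n - k) = m * (n - k) + maxRank 𝔽 m k (m * k - k) := by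
  exact le_antisymm (maxRank_le_add_maxRank hm hkn) (add_maxRank_le_maxRank hm hkn)
end
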